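/- One-dimensional case of the functional inequality: if φ, ψ: R → R ∪ {+∞} are Borel, even functions with φ(x) + ψ(ξ) ≥ xξ for all x, ξ ∈ R, then for every 0 ≤ ρ < 1, ∫_{R×R} e^{−φ(x)−ψ(ξ)+ρxξ} dx dξ ≤ 2π/√(1−ρ²). -/

import Mathlib

open scoped ENNReal

/-- The exponential of an extended real, valued in `ℝ≥0∞`, with `e^{-∞} = 0`, `e^{+∞} = ∞`. -/
noncomputable def expEReal (e : EReal) : ℝ≥0∞ :=
  if e = ⊥ then 0 else if e = ⊤ then ⊤ else ENNReal.ofReal (Real.exp e.toReal)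

open MeasureTheory Set

/-- A one-dimensional Brunn–Minkowski inequality for midpoints lying in an order-connected set. -/
lemma volume_add_volume_le_of_midpoint_mem {A B I : Set ℝ} (hA : A.Nonempty) (hB : B.Nonempty)
    (hI : I.OrdConnected) (hmem : ∀ a ∈ A, ∀ b ∈ B, (a + b) / 2 ∈ I) :
    volume A + volume B ≤ 2 * volume I := by
  have key : ∀ a ∈ A, ∀ a' ∈ A, a ≤ a' → ∀ b ∈ B, ∀ b' ∈ B, b ≤ b' →
      ENNReal.ofReal (a' - a) + ENNReal.ofReal (b' - b) ≤ 2 * volume I := by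
    intro a ha a' ha' haa b hb b' hb' hbb
    have hsub : Icc ((a + b) / 2) ((a' + b') / 2) ⊆ I :=
      hI.out (hmem a ha b hb) (hmem a' ha' b' hb')
    calc ENNReal.ofReal (a' - a) + ENNReal.ofReal (b' - b)
        = ENNReal.ofReal (2 * ((a' + b') / 2 - (a + b) / 2)) := by
          rw [← ENNReal.ofReal_add (by linarith) (by linarith)]
          congr 1
          ring
      _ = 2 * volume (Icc ((a + b) / 2) ((a' + b') / 2)) := by
          rw [ENNReal.ofReal_mul (by norm_num), Real.volume_Icc, ENNReal.ofReal_ofNat]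
      _ ≤ 2 * volume I := by gcongr
  have hdist : ∀ {S : Set ℝ} {x y : ℝ}, x ∈ S → y ∈ S →
      ∃ u ∈ S, ∃ v ∈ S, u ≤ v ∧ edist x y = ENNReal.ofReal (v - u) := by
    intro S x y hx hy
    rcases le_total x y with h | h
    · exact ⟨x, hx, y, hy, h, by
        rw [edist_comm, edist_dist, Real.dist_eq, abs_of_nonneg (by linarith)]⟩
    · exact ⟨y, hy, x, hx, h, by
        rw [edist_dist, Real.dist_eq, abs_of_nonneg (by linarith)]⟩
  refine (add_le_add (Real.volume_le_diam A) (Real.volume_le_diam B)).trans ?_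
  unfold Metric.ediam
  refine ENNReal.biSup_add_biSup_le' hA hB fun x hx y hy => ?_
  refine ENNReal.biSup_add_biSup_le' hA hB fun x' hx' y' hy' => ?_
  obtain ⟨a, ha, a', ha', haa, hax⟩ := hdist hx hx'
  obtain ⟨b, hb, b', hb', hbb, hby⟩ := hdist hy hy'
  rw [hax, hby]
  exact key a ha a' ha' haa b hb b' hb' hbb

/-- Prékopa–Leindler in dimension one, for functions of supremum one and a quasiconcave majorant. -/
lemma lintegral_add_lintegral_le_of_sup_eq_one {f g h : ℝ → ℝ}
    (hfm : Measurable f) (hgm : Measurable g) (hhm : Measurable h)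
    (hf0 : ∀ x, 0 ≤ f x) (hg0 : ∀ x, 0 ≤ g x) (hh0 : ∀ x, 0 ≤ h x)
    (hf1 : ∀ x, f x ≤ 1) (hg1 : ∀ x, g x ≤ 1)
    (hfs : ∀ c < 1, ∃ x, c < f x) (hgs : ∀ c < 1, ∃ x, c < g x)
    (hq : ∀ x y z, z ∈ Icc x y → min (h x) (h y) ≤ h z)
    (hfg : ∀ x y, f x * g y ≤ h ((x + y) / 2) ^ 2) :
    (∫⁻ x, ENNReal.ofReal (f x)) + ∫⁻ x, ENNReal.ofReal (g x) ≤
      2 * ∫⁻ x, ENNReal.ofReal (h x) := by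
  have hmeas : ∀ u : ℝ → ℝ, Measurable fun t => volume {a | t < u a} := fun u =>
    Antitone.measurable fun s t hst => measure_mono fun a (ha : t < u a) => hst.trans_lt ha
  rw [lintegral_eq_lintegral_meas_lt volume (.of_forall hf0) hfm.aemeasurable,
    lintegral_eq_lintegral_meas_lt volume (.of_forall hg0) hgm.aemeasurable,
    lintegral_eq_lintegral_meas_lt volume (.of_forall hh0) hhm.aemeasurable,
    ← lintegral_add_left (hmeas f), ← lintegral_const_mul _ (hmeas h)]
  refine setLIntegral_mono ((hmeas h).const_mul _) fun c (hc : 0 < c) => ?_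
  rcases lt_or_ge c 1 with hc1 | hc1
  · refine volume_add_volume_le_of_midpoint_mem (hfs c hc1) (hgs c hc1) ⟨?_⟩ ?_
    · intro x hx y hy z hz
      exact (lt_min hx hy).trans_le (hq x y z hz)
    · intro a (ha : c < f a) b (hb : c < g b)
      have : c ^ 2 < h ((a + b) / 2) ^ 2 := by
        refine lt_of_lt_of_le ?_ (hfg a b)
        rw [sq]
        exact mul_lt_mul'' ha hb hc.le hc.le
      exact lt_of_pow_lt_pow_left₀ 2 (hh0 _) this
  · have he : ∀ u : ℝ → ℝ, (∀ x, u x ≤ 1) → {a | c < u a} = ∅ := fun u hu =>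
      eq_empty_of_forall_notMem fun a (ha : c < u a) => absurd (hu a) (by linarith)
    simp [he f hf1, he g hg1]

lemma ENNReal.mul_le_sq_of_add_le_two_mul {a b c : ℝ≥0∞} (h : a + b ≤ 2 * c) :
    a * b ≤ c ^ 2 := by
  rcases eq_or_ne c ⊤ with rfl | hc
  · simp
  have hs : a + b ≠ ⊤ := ne_top_of_le_ne_top (ENNReal.mul_ne_top (by simp) hc) h
  rw [ENNReal.add_ne_top] at hs
  lift a to NNReal using hs.1
  lift b to NNReal using hs.2
  lift c to NNReal using hc
  norm_cast at h ⊢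
  rw [← NNReal.coe_le_coe] at h ⊢
  push_cast at h ⊢
  nlinarith [sq_nonneg ((a : ℝ) - b), a.2, b.2, c.2, NNReal.coe_nonneg a, NNReal.coe_nonneg b]

/-- Prékopa–Leindler in dimension one, for midpoints and a bounded quasiconcave majorant. -/
lemma lintegral_mul_lintegral_le_sq {f g h : ℝ → ℝ} {M : ℝ}
    (hfm : Measurable f) (hgm : Measurable g) (hhm : Measurable h)
    (hf0 : ∀ x, 0 ≤ f x) (hg0 : ∀ x, 0 ≤ g x) (hh0 : ∀ x, 0 ≤ h x) (hhM : ∀ x, h x ≤ M)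
    (hq : ∀ x y z, z ∈ Icc x y → min (h x) (h y) ≤ h z)
    (hfg : ∀ x y, f x * g y ≤ h ((x + y) / 2) ^ 2) :
    (∫⁻ x, ENNReal.ofReal (f x)) * ∫⁻ x, ENNReal.ofReal (g x) ≤
      (∫⁻ x, ENNReal.ofReal (h x)) ^ 2 := by
  by_cases hfz : ∀ x, f x = 0
  · simp [hfz]
  by_cases hgz : ∀ x, g x = 0
  · simp [hgz]
  push Not at hfz hgz
  obtain ⟨x₀, hx₀⟩ := hfz
  obtain ⟨y₀, hy₀⟩ := hgz
  have hx₀ : 0 < f x₀ := (hf0 x₀).lt_of_ne' hx₀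
  have hy₀ : 0 < g y₀ := (hg0 y₀).lt_of_ne' hy₀
  have hM : ∀ x y, f x * g y ≤ M ^ 2 := fun x y =>
    (hfg x y).trans (pow_le_pow_left₀ (hh0 _) (hhM _) 2)
  have hfb : BddAbove (range f) := ⟨M ^ 2 / g y₀, by
    rintro _ ⟨x, rfl⟩
    rw [le_div_iff₀ hy₀]
    exact hM x y₀⟩
  have hgb : BddAbove (range g) := ⟨M ^ 2 / f x₀, by
    rintro _ ⟨y, rfl⟩
    rw [le_div_iff₀ hx₀, mul_comm]
    exact hM x₀ y⟩
  set a := ⨆ x, f x with ha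
  set b := ⨆ x, g x with hb
  have ha0 : 0 < a := hx₀.trans_le (le_ciSup hfb x₀)
  have hb0 : 0 < b := hy₀.trans_le (le_ciSup hgb y₀)
  set k := √(a * b) with hk
  have hk0 : 0 < k := Real.sqrt_pos.2 (mul_pos ha0 hb0)
  have hk2 : k ^ 2 = a * b := Real.sq_sqrt (mul_pos ha0 hb0).le
  have hsup : ∀ {u : ℝ → ℝ} {s : ℝ}, 0 < s → s = ⨆ x, u x → ∀ c < 1, ∃ x, c < u x / s := by
    intro u s hs hsu c hc
    have : c * s < ⨆ x, u x := by rw [← hsu]; nlinarith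
    obtain ⟨x, hx⟩ := exists_lt_of_lt_ciSup this
    exact ⟨x, by rwa [lt_div_iff₀ hs]⟩
  have hnorm := lintegral_add_lintegral_le_of_sup_eq_one (f := fun x => f x / a)
    (g := fun x => g x / b) (h := fun x => h x / k) (hfm.div_const _) (hgm.div_const _)
    (hhm.div_const _) (fun x => div_nonneg (hf0 x) ha0.le) (fun x => div_nonneg (hg0 x) hb0.le)
    (fun x => div_nonneg (hh0 x) hk0.le) (fun x => (div_le_one ha0).2 (le_ciSup hfb x))
    (fun x => (div_le_one hb0).2 (le_ciSup hgb x)) (hsup ha0 ha) (hsup hb0 hb)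
    (fun x y z hz => by
      rw [min_div_div_right hk0.le]
      exact div_le_div_of_nonneg_right (hq x y z hz) hk0.le)
    (fun x y => by
      rw [div_pow, hk2, div_mul_div_comm]
      exact div_le_div_of_nonneg_right (hfg x y) (mul_pos ha0 hb0).le)
  have hscale : ∀ (u : ℝ → ℝ) {s : ℝ}, 0 < s → Measurable u →
      ∫⁻ x, ENNReal.ofReal (u x) = ENNReal.ofReal s * ∫⁻ x, ENNReal.ofReal (u x / s) := by
    intro u s hs hu
    rw [← lintegral_const_mul _ (by fun_prop)]
    refine lintegral_congr fun x => ?_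
    rw [← ENNReal.ofReal_mul hs.le, mul_div_cancel₀ _ hs.ne']
  rw [hscale f ha0 hfm, hscale g hb0 hgm, hscale h hk0 hhm, mul_mul_mul_comm, mul_pow,
    ← ENNReal.ofReal_mul ha0.le, ← ENNReal.ofReal_pow hk0.le, hk2]
  gcongr
  exact ENNReal.mul_le_sq_of_add_le_two_mul hnorm

lemma setLIntegral_Ioi_eq_lintegral_exp (F : ℝ → ℝ) :
    ∫⁻ x in Ioi 0, ENNReal.ofReal (F x) = ∫⁻ s, ENNReal.ofReal (Real.exp s * F (Real.exp s)) := by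
  have h := lintegral_image_eq_lintegral_abs_deriv_mul (s := univ) (f := Real.exp)
    (f' := Real.exp) MeasurableSet.univ (fun x _ => (Real.hasDerivAt_exp x).hasDerivWithinAt)
    Real.exp_injective.injOn (fun x => ENNReal.ofReal (F x))
  rw [image_univ, Real.range_exp, setLIntegral_univ] at h
  rw [h]
  refine lintegral_congr fun s => ?_
  rw [abs_of_pos (Real.exp_pos s), ENNReal.ofReal_mul (Real.exp_pos s).le]

lemma lintegral_eq_two_mul_setLIntegral_Ioi_of_even {F : ℝ → ℝ≥0∞} (hF : ∀ x, F (-x) = F x) :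
    ∫⁻ x, F x = 2 * ∫⁻ x in Ioi 0, F x := by
  have hneg : ∫⁻ x in Iio 0, F x = ∫⁻ x in Ioi 0, F x := by
    rw [← lintegral_indicator measurableSet_Iio, ← lintegral_indicator measurableSet_Ioi,
      ← lintegral_neg_eq_self]
    refine lintegral_congr fun x => ?_
    simp [indicator, hF]
  rw [← lintegral_add_compl F (measurableSet_Ioi (a := (0 : ℝ))), compl_Ioi,
    setLIntegral_congr Iio_ae_eq_Iic.symm, hneg, two_mul]

/-- Among dual pairs of even functions, Gaussians maximize the product of even moments. -/
lemma lintegral_moment_mul_le {f g : ℝ → ℝ} (hfm : Measurable f) (hgm : Measurable g)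
    (hf0 : ∀ x, 0 ≤ f x) (hg0 : ∀ x, 0 ≤ g x)
    (hfe : ∀ x, f (-x) = f x) (hge : ∀ x, g (-x) = g x)
    (hfg : ∀ x y, f x * g y ≤ Real.exp (-(x * y))) (n : ℕ) :
    (∫⁻ x, ENNReal.ofReal (f x * x ^ (2 * n))) * ∫⁻ x, ENNReal.ofReal (g x * x ^ (2 * n)) ≤
      (∫⁻ x, ENNReal.ofReal (Real.exp (-(x ^ 2 / 2)) * x ^ (2 * n))) ^ 2 := by
  have heven : ∀ x : ℝ, (-x) ^ (2 * n) = x ^ (2 * n) := fun x => (even_two_mul n).neg_pow x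
  rw [lintegral_eq_two_mul_setLIntegral_Ioi_of_even (by intro x; rw [hfe, heven]),
    lintegral_eq_two_mul_setLIntegral_Ioi_of_even (by intro x; rw [hge, heven]),
    lintegral_eq_two_mul_setLIntegral_Ioi_of_even (by intro x; rw [heven, neg_sq]),
    mul_mul_mul_comm, mul_pow, ← sq]
  gcongr
  simp only [setLIntegral_Ioi_eq_lintegral_exp (fun x => f x * x ^ (2 * n)),
    setLIntegral_Ioi_eq_lintegral_exp (fun x => g x * x ^ (2 * n)),
    setLIntegral_Ioi_eq_lintegral_exp (fun x => Real.exp (-(x ^ 2 / 2)) * x ^ (2 * n))]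
  set k : ℝ := 2 * n + 1 with hk
  have hk0 : 0 < k := by positivity
  have hH : ∀ s : ℝ, Real.exp s * (Real.exp (-(Real.exp s ^ 2 / 2)) * Real.exp s ^ (2 * n)) =
      Real.exp (k * s - Real.exp (2 * s) / 2) := by
    intro s
    rw [← Real.exp_nat_mul, ← Real.exp_nat_mul, ← Real.exp_add, ← Real.exp_add]
    congr 1
    push_cast
    ring
  have hconc : ConcaveOn ℝ univ fun s : ℝ => k * s - Real.exp (2 * s) / 2 := by
    have h1 : ConvexOn ℝ univ fun s : ℝ => Real.exp (2 * s) :=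
      convexOn_exp.comp_linearMap (LinearMap.mul ℝ ℝ 2)
    have h2 : ConcaveOn ℝ univ fun s : ℝ => k * s :=
      (LinearMap.mul ℝ ℝ k).concaveOn convex_univ
    have h3 := h2.sub (h1.smul (c := (1 / 2 : ℝ)) (by norm_num))
    refine h3.congr fun s _ => ?_
    simp only [Pi.sub_apply, smul_eq_mul]
    ring
  refine lintegral_mul_lintegral_le_sq (M := Real.exp (k * (Real.log k - 1) / 2))
    (by fun_prop) (by fun_prop) (by fun_prop)
    (fun x => by have := hf0 (Real.exp x); positivity)
    (fun x => by have := hg0 (Real.exp x); positivity) (fun x => by positivity) ?_ ?_ ?_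
  · intro s
    rw [hH, Real.exp_le_exp]
    have h1 := Real.add_one_le_exp (2 * s - Real.log k)
    rw [Real.exp_sub, Real.exp_log hk0, le_div_iff₀ hk0] at h1
    linarith
  · intro x y z hz
    simp only [hH]
    rw [← Real.exp_monotone.map_min, Real.exp_le_exp]
    exact hconc.min_le_of_mem_Icc (mem_univ _) (mem_univ _) hz
  · intro s t
    rw [hH]
    calc Real.exp s * (f (Real.exp s) * Real.exp s ^ (2 * n)) *
          (Real.exp t * (g (Real.exp t) * Real.exp t ^ (2 * n)))
        = (Real.exp s * Real.exp s ^ (2 * n) * (Real.exp t * Real.exp t ^ (2 * n))) *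
          (f (Real.exp s) * g (Real.exp t)) := by ring
      _ ≤ (Real.exp s * Real.exp s ^ (2 * n) * (Real.exp t * Real.exp t ^ (2 * n))) *
          Real.exp (-(Real.exp s * Real.exp t)) := by gcongr; exact hfg _ _
      _ = Real.exp (k * ((s + t) / 2) - Real.exp (2 * ((s + t) / 2)) / 2) ^ 2 := by
          rw [← Real.exp_nat_mul, ← Real.exp_nat_mul, ← Real.exp_nat_mul, ← Real.exp_add,
            ← Real.exp_add, ← Real.exp_add, ← Real.exp_add, ← Real.exp_add,
            mul_div_cancel₀ _ (two_ne_zero' ℝ)]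
          congr 1
          push_cast
          ring

lemma lintegral_mul_exp_eq_tsum {f g : ℝ → ℝ} (hfm : Measurable f) (hgm : Measurable g)
    (hf0 : ∀ x, 0 ≤ f x) (hg0 : ∀ x, 0 ≤ g x) (hfe : ∀ x, f (-x) = f x) (ρ : ℝ) :
    ∫⁻ p : ℝ × ℝ, ENNReal.ofReal (f p.1 * g p.2 * Real.exp (ρ * p.1 * p.2)) =
      ∑' n : ℕ, ENNReal.ofReal (ρ ^ (2 * n) / (2 * n).factorial) *
        ((∫⁻ x, ENNReal.ofReal (f x * x ^ (2 * n))) *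
          ∫⁻ y, ENNReal.ofReal (g y * y ^ (2 * n))) := by
  have hflip : ∫⁻ p : ℝ × ℝ, ENNReal.ofReal (f p.1 * g p.2 * Real.exp (ρ * p.1 * p.2)) =
      ∫⁻ p : ℝ × ℝ, ENNReal.ofReal (f p.1 * g p.2 * Real.exp (-(ρ * p.1 * p.2))) := by
    rw [Measure.volume_eq_prod, lintegral_prod _ (by fun_prop), lintegral_prod _ (by fun_prop),
      ← lintegral_neg_eq_self]
    simp only [hfe, mul_neg, neg_mul]
  have hcosh : ∫⁻ p : ℝ × ℝ, ENNReal.ofReal (f p.1 * g p.2 * Real.exp (ρ * p.1 * p.2)) =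
      ∫⁻ p : ℝ × ℝ, ENNReal.ofReal (f p.1 * g p.2 * Real.cosh (ρ * p.1 * p.2)) := by
    rw [← ENNReal.mul_right_inj (two_ne_zero) (ENNReal.ofNat_ne_top (n := 2))]
    conv_lhs => rw [two_mul]; enter [2]; rw [hflip]
    rw [← lintegral_add_left (by fun_prop), ← lintegral_const_mul _ (by fun_prop)]
    refine lintegral_congr fun p => ?_
    have h := mul_nonneg (hf0 p.1) (hg0 p.2)
    rw [← ENNReal.ofReal_add (by positivity) (by positivity), ← ENNReal.ofReal_ofNat 2,
      ← ENNReal.ofReal_mul (by norm_num), Real.cosh_eq]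
    congr 1
    ring
  have hcoef : ∀ n : ℕ, 0 ≤ ρ ^ (2 * n) / (2 * n).factorial := fun n =>
    div_nonneg ((even_two_mul n).pow_nonneg ρ) (Nat.cast_nonneg _)
  have hpow : ∀ (n : ℕ) (x : ℝ), 0 ≤ x ^ (2 * n) := fun n x => (even_two_mul n).pow_nonneg x
  have hterm : ∀ p : ℝ × ℝ, ENNReal.ofReal (f p.1 * g p.2 * Real.cosh (ρ * p.1 * p.2)) =
      ∑' n : ℕ, ENNReal.ofReal (ρ ^ (2 * n) / (2 * n).factorial) *
        (ENNReal.ofReal (f p.1 * p.1 ^ (2 * n)) * ENNReal.ofReal (g p.2 * p.2 ^ (2 * n))) := by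
    intro p
    have hs := (Real.hasSum_cosh (ρ * p.1 * p.2)).mul_left (f p.1 * g p.2)
    rw [← hs.tsum_eq, ENNReal.ofReal_tsum_of_nonneg _ hs.summable]
    · refine tsum_congr fun n => ?_
      rw [← ENNReal.ofReal_mul (mul_nonneg (hf0 _) (hpow n _)), ← ENNReal.ofReal_mul (hcoef n)]
      congr 1
      ring
    · exact fun n => mul_nonneg (mul_nonneg (hf0 _) (hg0 _))
        (div_nonneg (hpow n _) (Nat.cast_nonneg _))
  simp only [hcosh, hterm]
  rw [lintegral_tsum fun n => by fun_prop]
  refine tsum_congr fun n => ?_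
  rw [lintegral_const_mul _ (by fun_prop), Measure.volume_eq_prod,
    lintegral_prod_mul (f := fun x => ENNReal.ofReal (f x * x ^ (2 * n)))
      (g := fun y => ENNReal.ofReal (g y * y ^ (2 * n))) (by fun_prop) (by fun_prop)]

lemma lintegral_exp_neg_mul_sq {b : ℝ} (hb : 0 < b) :
    ∫⁻ x : ℝ, ENNReal.ofReal (Real.exp (-b * x ^ 2)) = ENNReal.ofReal √(Real.pi / b) := by
  rw [← ofReal_integral_eq_lintegral_ofReal (integrable_exp_neg_mul_sq hb)
    (.of_forall fun x => (Real.exp_pos _).le), integral_gaussian]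

lemma lintegral_gaussian_correlated {ρ : ℝ} (hρ0 : 0 ≤ ρ) (hρ1 : ρ < 1) :
    ∫⁻ p : ℝ × ℝ, ENNReal.ofReal
      (Real.exp (-(p.1 ^ 2 / 2)) * Real.exp (-(p.2 ^ 2 / 2)) * Real.exp (ρ * p.1 * p.2)) =
      ENNReal.ofReal (2 * Real.pi / √(1 - ρ ^ 2)) := by
  have hρ : 0 < 1 - ρ ^ 2 := by nlinarith
  have hinner : ∀ x : ℝ, ∫⁻ y : ℝ, ENNReal.ofReal
      (Real.exp (-(x ^ 2 / 2)) * Real.exp (-(y ^ 2 / 2)) * Real.exp (ρ * x * y)) =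
      ENNReal.ofReal (Real.exp (-((1 - ρ ^ 2) / 2) * x ^ 2)) *
        ENNReal.ofReal √(Real.pi / (1 / 2)) := by
    intro x
    rw [← lintegral_exp_neg_mul_sq (by norm_num),
      ← lintegral_sub_right_eq_self (fun y : ℝ => ENNReal.ofReal (Real.exp (-(1 / 2) * y ^ 2)))
        (ρ * x), ← lintegral_const_mul _ (by fun_prop)]
    refine lintegral_congr fun y => ?_
    rw [← ENNReal.ofReal_mul (Real.exp_pos _).le, ← Real.exp_add, ← Real.exp_add, ← Real.exp_add]
    congr 2
    ring
  rw [Measure.volume_eq_prod, lintegral_prod _ (by fun_prop)]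
  simp only [hinner]
  rw [lintegral_mul_const _ (by fun_prop), lintegral_exp_neg_mul_sq (by linarith),
    ← ENNReal.ofReal_mul (Real.sqrt_nonneg _), ← Real.sqrt_mul (by positivity)]
  congr 1
  rw [show Real.pi / ((1 - ρ ^ 2) / 2) * (Real.pi / (1 / 2)) =
    (2 * Real.pi) ^ 2 / (1 - ρ ^ 2) by field_simp, Real.sqrt_div (by positivity),
    Real.sqrt_sq (by positivity)]

/-- The density `e^{-φ}`, with value `0` where `φ = +∞`. -/
noncomputable def expNeg (φ : ℝ → EReal) (x : ℝ) : ℝ :=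
  if φ x = ⊤ then 0 else Real.exp (-(φ x).toReal)

lemma expNeg_nonneg (φ : ℝ → EReal) (x : ℝ) : 0 ≤ expNeg φ x := by
  unfold expNeg
  split_ifs <;> positivity

lemma measurable_expNeg {φ : ℝ → EReal} (hφ : Measurable φ) : Measurable (expNeg φ) :=
  Measurable.ite (hφ (measurableSet_singleton ⊤)) measurable_const
    (Real.measurable_exp.comp hφ.ereal_toReal.neg)

lemma expNeg_mul_expNeg_le {φ ψ : ℝ → EReal} (hφb : ∀ x, φ x ≠ ⊥) (hψb : ∀ ξ, ψ ξ ≠ ⊥)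
    {x ξ c : ℝ} (h : (c : EReal) ≤ φ x + ψ ξ) :
    expNeg φ x * expNeg ψ ξ ≤ Real.exp (-c) := by
  have hx := hφb x
  have hξ := hψb ξ
  unfold expNeg
  generalize φ x = a at *
  generalize ψ ξ = b at *
  split_ifs with ha hb hb
  · simp [Real.exp_nonneg]
  · simp [Real.exp_nonneg]
  · simp [Real.exp_nonneg]
  · lift a to ℝ using ⟨ha, hx⟩
    lift b to ℝ using ⟨hb, hξ⟩
    rw [← Real.exp_add, Real.exp_le_exp]
    norm_cast at h
    simp only [EReal.toReal_coe]
    linarith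

lemma expEReal_sub_sub {φ ψ : ℝ → EReal} (hφb : ∀ x, φ x ≠ ⊥) (hψb : ∀ ξ, ψ ξ ≠ ⊥)
    (x ξ c : ℝ) :
    expEReal ((c : EReal) - φ x - ψ ξ) =
      ENNReal.ofReal (expNeg φ x * expNeg ψ ξ * Real.exp c) := by
  have hx := hφb x
  have hξ := hψb ξ
  unfold expNeg
  generalize φ x = a at *
  generalize ψ ξ = b at *
  split_ifs with ha hb hb
  · subst ha hb
    simp [expEReal]
  · subst ha
    simp [expEReal, EReal.bot_sub]
  · subst hb
    simp [expEReal]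
  · lift a to ℝ using ⟨ha, hx⟩
    lift b to ℝ using ⟨hb, hξ⟩
    rw [← EReal.coe_sub, ← EReal.coe_sub, expEReal, if_neg (EReal.coe_ne_bot _),
      if_neg (EReal.coe_ne_top _), EReal.toReal_coe, EReal.toReal_coe, EReal.toReal_coe,
      ← Real.exp_add, ← Real.exp_add]
    congr 2
    ring

/-- One-dimensional functional inequality: if `φ, ψ : ℝ → ℝ ∪ {+∞}` are Borel even
functions with `φ(x) + ψ(ξ) ≥ xξ` for all `x, ξ`, then for `0 ≤ ρ < 1`,
`∫_{ℝ×ℝ} e^{-φ(x)-ψ(ξ)+ρxξ} dx dξ ≤ 2π/√(1-ρ²)`. -/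
theorem functional_inequality_dim_one (φ ψ : ℝ → EReal)
    (hφm : Measurable φ) (hψm : Measurable ψ)
    (hφb : ∀ x, φ x ≠ ⊥) (hψb : ∀ ξ, ψ ξ ≠ ⊥)
    (hφe : ∀ x, φ (-x) = φ x) (hψe : ∀ ξ, ψ (-ξ) = ψ ξ)
    (hdual : ∀ x ξ : ℝ, ((x * ξ : ℝ) : EReal) ≤ φ x + ψ ξ)
    (ρ : ℝ) (hρ0 : 0 ≤ ρ) (hρ1 : ρ < 1) :
    (∫⁻ p : ℝ × ℝ, expEReal (((ρ * p.1 * p.2 : ℝ) : EReal) - φ p.1 - ψ p.2)) ≤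
      ENNReal.ofReal (2 * Real.pi / Real.sqrt (1 - ρ^2)) := by
  have hfm := measurable_expNeg hφm
  have hgm := measurable_expNeg hψm
  have hfe : ∀ x, expNeg φ (-x) = expNeg φ x := fun x => by simp only [expNeg, hφe]
  have hge : ∀ x, expNeg ψ (-x) = expNeg ψ x := fun x => by simp only [expNeg, hψe]
  have hfg : ∀ x ξ, expNeg φ x * expNeg ψ ξ ≤ Real.exp (-(x * ξ)) := fun x ξ =>
    expNeg_mul_expNeg_le hφb hψb (hdual x ξ)
  simp only [expEReal_sub_sub hφb hψb]
  rw [lintegral_mul_exp_eq_tsum hfm hgm (expNeg_nonneg φ) (expNeg_nonneg ψ) hfe,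
    ← lintegral_gaussian_correlated hρ0 hρ1,
    lintegral_mul_exp_eq_tsum (f := fun x => Real.exp (-(x ^ 2 / 2)))
      (g := fun x => Real.exp (-(x ^ 2 / 2))) (by fun_prop) (by fun_prop)
      (fun x => (Real.exp_pos _).le) (fun x => (Real.exp_pos _).le) (fun x => by rw [neg_sq])]
  refine ENNReal.tsum_le_tsum fun n => ?_
  rw [← sq]
  gcongr
  exact lintegral_moment_mul_le hfm hgm (expNeg_nonneg φ) (expNeg_nonneg ψ) hfe hge hfg n
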